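/- arXiv:1903.03690 — 6 statements merged into one kernel-verified Lean document; each statement's English description precedes it below -/
import Mathlib

section
/- Assume there is a family of integrable counterfactual outcomes Y_{x,m} : Ω → ℝ for x, m ∈ {0,1} satisfying: (consistency) Y(ω) = Y_{A(ω),M(ω)}(ω) for every ω ∈ Ω; (sequential randomization) for every x, m ∈ {0,1}, Y_{x,m} is conditionally independent of A given (W, S), and Y_{x,m} is conditionally independent of M given (Z, A, W, S); and (common outcome model across sites) E[Y | M=m, Z=z, A=a, W=w, S=1] = E[Y | M=m, Z=z, A=a, W=w, S=0] for all m, z ∈ {0,1} and w ∈ 𝒲. Then the transported counterfactual mean of Y under treatment A=a and the stochastic intervention drawing M from g*(·|W) is identified by the transported estimand: E[ Σ_{m∈{0,1}} g*(m|W) · Y_{a,m} | S=0 ] = Ψ(P). -/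
open MeasureTheory

noncomputable section

/-- Discrete transported-mediation setup: a probability space `(Ω, P)` carrying
binary random variables `S, A, Z, M`, a covariate `W` valued in a nonempty finite
set `𝒲`, and an outcome `Y` valued in a nonempty finite set `ySet ⊆ ℝ`, with
strong positivity of every joint cell. -/
structure TransportSetup (Ω : Type*) [MeasurableSpace Ω]
    (𝒲 : Type*) [MeasurableSpace 𝒲] [MeasurableSingletonClass 𝒲]
    [Fintype 𝒲] [Nonempty 𝒲] where
  P : Measure Ω
  isProb : IsProbabilityMeasure P
  S : Ω → Fin 2
  A : Ω → Fin 2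
  Z : Ω → Fin 2
  M : Ω → Fin 2
  W : Ω → 𝒲
  Y : Ω → ℝ
  ySet : Finset ℝ
  ySet_nonempty : ySet.Nonempty
  hY : ∀ ω, Y ω ∈ ySet
  measS : Measurable S
  measA : Measurable A
  measZ : Measurable Z
  measM : Measurable M
  measW : Measurable W
  measY : Measurable Y
  positivity : ∀ (s' x z m : Fin 2) (w : 𝒲), ∀ y ∈ ySet,
    0 < P {ω | S ω = s' ∧ W ω = w ∧ A ω = x ∧ Z ω = z ∧ M ω = m ∧ Y ω = y}

namespace TransportSetup

variable {Ω : Type*} [MeasurableSpace Ω]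
  {𝒲 : Type*} [MeasurableSpace 𝒲] [MeasurableSingletonClass 𝒲]
  [Fintype 𝒲] [Nonempty 𝒲]
variable (T : TransportSetup Ω 𝒲)

/-- Probability of an event, as a real number. -/
def pr (E : Set Ω) : ℝ := (T.P E).toReal

/-- Conditional probability `P(E | F)`. -/
def cpr (E F : Set Ω) : ℝ := T.pr (E ∩ F) / T.pr F

/-- Conditional expectation `E[f | F]` of a real random variable given an event. -/
def cexp (f : Ω → ℝ) (F : Set Ω) : ℝ := (∫ ω in F, f ω ∂T.P) / T.pr F

/-- `Q̄_Y(m,z,x,w) = E[Y | M=m, Z=z, A=x, W=w, S=1]`. -/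
def qbarY (m z x : Fin 2) (w : 𝒲) : ℝ :=
  T.cexp T.Y {ω | T.M ω = m ∧ T.Z ω = z ∧ T.A ω = x ∧ T.W ω = w ∧ T.S ω = 1}

/-- `P(Z=z | A=x, W=w, S=s)`. -/
def pZ (x z : Fin 2) (w : 𝒲) (s : Fin 2) : ℝ :=
  T.cpr {ω | T.Z ω = z} {ω | T.A ω = x ∧ T.W ω = w ∧ T.S ω = s}

/-- `P(S=s | W=w)`. -/
def pSW (s : Fin 2) (w : 𝒲) : ℝ := T.cpr {ω | T.S ω = s} {ω | T.W ω = w}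

/-- `P(M=m | Z=z, A=x, W=w, S=1)`. -/
def pM (m z x : Fin 2) (w : 𝒲) : ℝ :=
  T.cpr {ω | T.M ω = m} {ω | T.Z ω = z ∧ T.A ω = x ∧ T.W ω = w ∧ T.S ω = 1}

/-- `P(A=x | W=w, S=s)`. -/
def pA (x : Fin 2) (w : 𝒲) (s : Fin 2) : ℝ :=
  T.cpr {ω | T.A ω = x} {ω | T.W ω = w ∧ T.S ω = s}

/-- `P(S=0)`. -/
def pS0 : ℝ := T.pr {ω | T.S ω = 0}

/-- `P(W=w | S=0)`. -/
def pWS0 (w : 𝒲) : ℝ := T.cpr {ω | T.W ω = w} {ω | T.S ω = 0}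

/-- The transported estimand `Ψ(P)`. -/
def Psi (gs : Fin 2 → 𝒲 → ℝ) (a : Fin 2) : ℝ :=
  ∑ w : 𝒲, ∑ z : Fin 2, ∑ m : Fin 2,
    T.pWS0 w * T.pZ a z w 0 * gs m w * T.qbarY m z a w

/-- The transport-mediation weight `H`. -/
def Hwt (gs : Fin 2 → 𝒲 → ℝ) (a : Fin 2) (ω : Ω) : ℝ :=
  (gs (T.M ω) (T.W ω) * T.pZ a (T.Z ω) (T.W ω) 0 * T.pSW 0 (T.W ω) *
    (if T.S ω = 1 ∧ T.A ω = a then (1 : ℝ) else 0)) /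
  (T.pM (T.M ω) (T.Z ω) a (T.W ω) * T.pZ a (T.Z ω) (T.W ω) 1 * T.pA a (T.W ω) 1 *
    T.pSW 1 (T.W ω) * T.pS0)

/-- `Q̄_M(z,x,w) = Σ_m g*(m|w) Q̄_Y(m,z,x,w)`. -/
def qbarM (gs : Fin 2 → 𝒲 → ℝ) (z x : Fin 2) (w : 𝒲) : ℝ :=
  ∑ m : Fin 2, gs m w * T.qbarY m z x w

/-- `Q̄_Z(w) = Σ_z P(Z=z|A=a,W=w,S=0) Q̄_M(z,a,w)`. -/
def qbarZ (gs : Fin 2 → 𝒲 → ℝ) (a : Fin 2) (w : 𝒲) : ℝ :=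
  ∑ z : Fin 2, T.pZ a z w 0 * T.qbarM gs z a w

/-- `D_Y`, the `Y`-component of the (unrestricted-model) efficient influence curve. -/
def DY (gs : Fin 2 → 𝒲 → ℝ) (a : Fin 2) (ω : Ω) : ℝ :=
  (T.Y ω - T.qbarY (T.M ω) (T.Z ω) (T.A ω) (T.W ω)) * T.Hwt gs a ω

/-- `D_Z`, the `Z`-component of the efficient influence curve. -/
def DZ (gs : Fin 2 → 𝒲 → ℝ) (a : Fin 2) (ω : Ω) : ℝ :=
  (T.qbarM gs (T.Z ω) a (T.W ω) - T.qbarZ gs a (T.W ω)) *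
    (if T.S ω = 0 ∧ T.A ω = a then (1 : ℝ) else 0) / (T.pA a (T.W ω) 0 * T.pS0)

/-- `D_W`, the `W`-component of the efficient influence curve. -/
def DW (gs : Fin 2 → 𝒲 → ℝ) (a : Fin 2) (ω : Ω) : ℝ :=
  (T.qbarZ gs a (T.W ω) - T.Psi gs a) *
    (if T.S ω = 0 then (1 : ℝ) else 0) / T.pS0


end TransportSetup

theorem aux_indep {Ω : Type*} [MeasurableSpace Ω] (μ : Measure Ω) [IsFiniteMeasure μ]
    (f : Ω → ℝ) (hf : Integrable f μ) (C F : Set Ω) (hC : MeasurableSet C) (hF : MeasurableSet F)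
    (hFp : (μ F).toReal ≠ 0)
    (h : ∀ B : Set ℝ, MeasurableSet B →
      (μ (({ω | f ω ∈ B} ∩ C) ∩ F)).toReal / (μ F).toReal =
      (μ ({ω | f ω ∈ B} ∩ F)).toReal / (μ F).toReal * ((μ (C ∩ F)).toReal / (μ F).toReal)) :
    (∫ ω in C ∩ F, f ω ∂μ) * (μ F).toReal = (∫ ω in F, f ω ∂μ) * (μ (C ∩ F)).toReal := by
  have hm : μ F • (μ.restrict (C ∩ F)).map f = μ (C ∩ F) • (μ.restrict F).map f := by
    ext B hB
    have h1 := h B hB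
    simp only [Measure.smul_apply, smul_eq_mul]
    rw [Measure.map_apply_of_aemeasurable hf.aemeasurable.restrict hB,
      Measure.map_apply_of_aemeasurable hf.aemeasurable.restrict hB,
      Measure.restrict_apply' (hC.inter hF), Measure.restrict_apply' hF]
    rw [← ENNReal.toReal_eq_toReal_iff' (by finiteness) (by finiteness), ENNReal.toReal_mul,
      ENNReal.toReal_mul]
    field_simp at h1
    have e1 : f ⁻¹' B ∩ (C ∩ F) = ({ω | f ω ∈ B} ∩ C) ∩ F := by
      rw [Set.inter_assoc]; rfl
    have e2 : f ⁻¹' B ∩ F = {ω | f ω ∈ B} ∩ F := rfl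
    rw [e1, e2]
    linarith
  have h2 := congrArg (fun ν : Measure ℝ => ∫ x, x ∂ν) hm
  simp only [integral_smul_measure, smul_eq_mul] at h2
  rw [integral_map hf.aemeasurable.restrict (by fun_prop),
    integral_map hf.aemeasurable.restrict (by fun_prop)] at h2
  linarith

theorem aux_split {Ω : Type*} [MeasurableSpace Ω] (μ : Measure Ω)
    {κ : Type*} [Fintype κ] [MeasurableSpace κ] [MeasurableSingletonClass κ]
    (K : Ω → κ) (hK : Measurable K)
    (f : Ω → ℝ) (hf : Integrable f μ) (F : Set Ω) (hF : MeasurableSet F) :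
    ∫ ω in F, f ω ∂μ = ∑ k, ∫ ω in {ω | K ω = k} ∩ F, f ω ∂μ := by
  rw [← integral_iUnion_fintype]
  · congr 2
    ext ω
    simp
  · intro k
    exact (hK (measurableSet_singleton k)).inter hF
  · intro i j hij
    rw [Function.onFun, Set.disjoint_left]
    rintro ω ⟨h1, _⟩ ⟨h2, _⟩
    exact hij (h1.symm.trans h2)
  · intro k
    exact hf.integrableOn

/-- Given integrable counterfactual outcomes `Y_{x,m}` satisfying
consistency, sequential randomization (`Y_{x,m} ⫫ A | (W,S)` and
`Y_{x,m} ⫫ M | (Z,A,W,S)`), and a common outcome model across sites, the transported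
counterfactual mean of `Y` under treatment `A = a` and the stochastic intervention
drawing `M` from `g*(·|W)` is identified by the transported estimand `Ψ(P)`. -/
theorem transported_stochastic_mean_identification
    {Ω : Type*} [MeasurableSpace Ω]
    {𝒲 : Type*} [MeasurableSpace 𝒲] [MeasurableSingletonClass 𝒲]
    [Fintype 𝒲] [Nonempty 𝒲]
    (T : TransportSetup Ω 𝒲) (a : Fin 2)
    (gs : Fin 2 → 𝒲 → ℝ)
    (hgs_pos : ∀ (m : Fin 2) (w : 𝒲), 0 < gs m w ∧ gs m w < 1)
    (hgs_sum : ∀ w : 𝒲, gs 0 w + gs 1 w = 1)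
    -- the family of counterfactual outcomes `Y_{x,m}`
    (Yc : Fin 2 → Fin 2 → Ω → ℝ)
    (hInt : ∀ (x m : Fin 2), MeasureTheory.Integrable (Yc x m) T.P)
    -- consistency: `Y(ω) = Y_{A(ω),M(ω)}(ω)`
    (hCons : ∀ ω, T.Y ω = Yc (T.A ω) (T.M ω) ω)
    -- sequential randomization: `Y_{x,m} ⫫ A | (W, S)`
    (hSR_A : ∀ (x m x' s' : Fin 2) (w : 𝒲) (B : Set ℝ), MeasurableSet B →
      T.cpr ({ω | Yc x m ω ∈ B} ∩ {ω | T.A ω = x'}) {ω | T.W ω = w ∧ T.S ω = s'} =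
      T.cpr {ω | Yc x m ω ∈ B} {ω | T.W ω = w ∧ T.S ω = s'} *
        T.cpr {ω | T.A ω = x'} {ω | T.W ω = w ∧ T.S ω = s'})
    -- sequential randomization: `Y_{x,m} ⫫ M | (Z, A, W, S)`
    (hSR_M : ∀ (x m m' z x' s' : Fin 2) (w : 𝒲) (B : Set ℝ), MeasurableSet B →
      T.cpr ({ω | Yc x m ω ∈ B} ∩ {ω | T.M ω = m'})
          {ω | T.Z ω = z ∧ T.A ω = x' ∧ T.W ω = w ∧ T.S ω = s'} =
      T.cpr {ω | Yc x m ω ∈ B} {ω | T.Z ω = z ∧ T.A ω = x' ∧ T.W ω = w ∧ T.S ω = s'} *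
        T.cpr {ω | T.M ω = m'} {ω | T.Z ω = z ∧ T.A ω = x' ∧ T.W ω = w ∧ T.S ω = s'})
    -- common outcome model across sites
    (hCommon : ∀ (m z : Fin 2) (w : 𝒲),
      T.cexp T.Y {ω | T.M ω = m ∧ T.Z ω = z ∧ T.A ω = a ∧ T.W ω = w ∧ T.S ω = 1} =
      T.cexp T.Y {ω | T.M ω = m ∧ T.Z ω = z ∧ T.A ω = a ∧ T.W ω = w ∧ T.S ω = 0}) :
    T.cexp (fun ω => ∑ m : Fin 2, gs m (T.W ω) * Yc a m ω) {ω | T.S ω = 0} =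
      T.Psi gs a := by
  have := T.isProb
  have hSW : ∀ w s, MeasurableSet {ω | T.W ω = w ∧ T.S ω = s} := fun w s =>
    (T.measW (measurableSet_singleton w)).inter (T.measS (measurableSet_singleton s))
  have hAm : ∀ x, MeasurableSet {ω | T.A ω = x} := fun x => T.measA (measurableSet_singleton x)
  have hZm : ∀ x, MeasurableSet {ω | T.Z ω = x} := fun x => T.measZ (measurableSet_singleton x)
  have hMm : ∀ x, MeasurableSet {ω | T.M ω = x} := fun x => T.measM (measurableSet_singleton x)
  have hSm : MeasurableSet {ω | T.S ω = 0} := T.measS (measurableSet_singleton 0)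
  have hASW : ∀ x w s, MeasurableSet {ω | T.A ω = x ∧ T.W ω = w ∧ T.S ω = s} := fun x w s =>
    (hAm x).inter (hSW w s)
  have hZASW : ∀ z x w s, MeasurableSet {ω | T.Z ω = z ∧ T.A ω = x ∧ T.W ω = w ∧ T.S ω = s} :=
    fun z x w s => (hZm z).inter (hASW x w s)
  have hMZ : ∀ m z x w s,
      MeasurableSet {ω | T.M ω = m ∧ T.Z ω = z ∧ T.A ω = x ∧ T.W ω = w ∧ T.S ω = s} :=
    fun m z x w s => (hMm m).inter (hZASW z x w s)
  obtain ⟨y, hy⟩ := T.ySet_nonempty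
  -- positivity of cells
  have hp : ∀ (E : Set Ω) (m z x s : Fin 2) (w : 𝒲),
      {ω | T.M ω = m ∧ T.Z ω = z ∧ T.A ω = x ∧ T.W ω = w ∧ T.S ω = s} ⊆ E →
      (T.P E).toReal ≠ 0 := by
    intro E m z x s w hE
    refine (ENNReal.toReal_pos ?_ (measure_ne_top _ _)).ne'
    refine ((T.positivity s x z m w y hy).trans_le (measure_mono ?_)).ne'
    rintro ω ⟨h1, h2, h3, h4, h5, h6⟩
    exact hE ⟨h5, h4, h3, h2, h1⟩
  have key : ∀ m w, ∫ ω in {ω | T.W ω = w ∧ T.S ω = 0}, Yc a m ω ∂T.P =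
      ∑ z, T.pr {ω | T.W ω = w ∧ T.S ω = 0} * T.pZ a z w 0 * T.qbarY m z a w := by
    intro m w
    have p1 := hp {ω | T.W ω = w ∧ T.S ω = 0} 0 0 0 0 w (fun ω h => ⟨h.2.2.2.1, h.2.2.2.2⟩)
    have p2 := hp {ω | T.A ω = a ∧ T.W ω = w ∧ T.S ω = 0} 0 0 a 0 w
      (fun ω h => ⟨h.2.2.1, h.2.2.2.1, h.2.2.2.2⟩)
    have k1 := aux_indep T.P (Yc a m) (hInt a m) {ω | T.A ω = a} {ω | T.W ω = w ∧ T.S ω = 0}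
      (hAm a) (hSW w 0) p1 (fun B hB => hSR_A a m a 0 w B hB)
    have k2 := aux_split T.P T.Z T.measZ (Yc a m) (hInt a m)
      {ω | T.A ω = a ∧ T.W ω = w ∧ T.S ω = 0} (hASW a w 0)
    have k3 : ∀ z, ∫ ω in {ω | T.Z ω = z} ∩ {ω | T.A ω = a ∧ T.W ω = w ∧ T.S ω = 0},
        Yc a m ω ∂T.P =
        T.pr {ω | T.A ω = a ∧ T.W ω = w ∧ T.S ω = 0} * T.pZ a z w 0 * T.qbarY m z a w := by
      intro z
      have p3 := hp {ω | T.Z ω = z ∧ T.A ω = a ∧ T.W ω = w ∧ T.S ω = 0} 0 z a 0 w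
        (fun ω h => h.2)
      have p4 := hp _ m z a 0 w subset_rfl
      have k4 := aux_indep T.P (Yc a m) (hInt a m) {ω | T.M ω = m}
        {ω | T.Z ω = z ∧ T.A ω = a ∧ T.W ω = w ∧ T.S ω = 0}
        (hMm m) (hZASW z a w 0) p3 (fun B hB => hSR_M a m m z a 0 w B hB)
      have k5 : ∫ ω in {ω | T.M ω = m ∧ T.Z ω = z ∧ T.A ω = a ∧ T.W ω = w ∧ T.S ω = 0},
          Yc a m ω ∂T.P =
          ∫ ω in {ω | T.M ω = m ∧ T.Z ω = z ∧ T.A ω = a ∧ T.W ω = w ∧ T.S ω = 0},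
          T.Y ω ∂T.P := by
        refine setIntegral_congr_fun (hMZ m z a w 0) ?_
        rintro ω ⟨h1, h2, h3, h4, h5⟩
        simp only [hCons ω, h1, h3]
      change (∫ ω in {ω | T.M ω = m ∧ T.Z ω = z ∧ T.A ω = a ∧ T.W ω = w ∧ T.S ω = 0},
          Yc a m ω ∂T.P) * _ = _ * (T.P {ω | T.M ω = m ∧ T.Z ω = z ∧ T.A ω = a ∧ T.W ω = w ∧
          T.S ω = 0}).toReal at k4
      rw [k5] at k4
      change ∫ ω in {ω | T.Z ω = z ∧ T.A ω = a ∧ T.W ω = w ∧ T.S ω = 0}, Yc a m ω ∂T.P = 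
        (T.P _).toReal * ((T.P {ω | T.Z ω = z ∧ T.A ω = a ∧ T.W ω = w ∧ T.S ω = 0}).toReal /
          (T.P _).toReal) * _
      rw [TransportSetup.qbarY, hCommon, TransportSetup.cexp, TransportSetup.pr]
      rw [mul_div_cancel₀ _ p2, ← mul_div_assoc, eq_div_iff p4]
      linarith
    rw [Finset.sum_congr rfl (fun z _ => k3 z)] at k2
    change (∫ ω in {ω | T.A ω = a ∧ T.W ω = w ∧ T.S ω = 0}, Yc a m ω ∂T.P) * _ =
      _ * (T.P {ω | T.A ω = a ∧ T.W ω = w ∧ T.S ω = 0}).toReal at k1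
    rw [k2] at k1
    apply mul_right_cancel₀ p2
    rw [← k1, Finset.sum_mul, Finset.sum_mul]
    refine Finset.sum_congr rfl fun z _ => ?_
    simp only [TransportSetup.pr]
    ring
  have hbd : ∀ m, Integrable (fun ω => gs m (T.W ω) * Yc a m ω) T.P := by
    intro m
    refine (hInt a m).bdd_mul (c := 1) ?_ ?_
    · exact ((measurable_of_finite (gs m)).comp T.measW).aestronglyMeasurable
    · refine Filter.Eventually.of_forall fun ω => ?_
      rw [Real.norm_eq_abs, abs_of_pos (hgs_pos m _).1]
      exact (hgs_pos m _).2.le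
  rw [TransportSetup.cexp, aux_split T.P T.W T.measW _
    (integrable_finsetSum _ fun m _ => hbd m) _ hSm, Finset.sum_div, TransportSetup.Psi]
  refine Finset.sum_congr rfl fun w _ => ?_
  have hw : ∫ ω in {ω | T.W ω = w} ∩ {ω | T.S ω = 0}, ∑ m, gs m (T.W ω) * Yc a m ω ∂T.P =
      ∑ m, gs m w * ∫ ω in {ω | T.W ω = w ∧ T.S ω = 0}, Yc a m ω ∂T.P := by
    rw [integral_finsetSum _ fun m _ => (hbd m).integrableOn]
    refine Finset.sum_congr rfl fun m _ => ?_
    rw [← integral_const_mul]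
    refine setIntegral_congr_fun (hSW w 0) ?_
    rintro ω ⟨h1, h2⟩
    have h3 : T.W ω = w := h1
    simp only [h3]
  rw [hw, Finset.sum_comm, Finset.sum_div]
  refine Finset.sum_congr rfl fun m _ => ?_
  rw [key, Finset.mul_sum, Finset.sum_div]
  refine Finset.sum_congr rfl fun z _ => ?_
  have e : T.pWS0 w = T.pr {ω | T.W ω = w ∧ T.S ω = 0} / T.pr {ω | T.S ω = 0} := rfl
  rw [e]
  ring
end
end

section
/- The transport-mediation weight H satisfies E_P[H] = 1 and E_P[H·Y] = Ψ(P); consequently the population stabilized inverse-probability-of-treatment-weighted functional E_P[H·Y] / E_P[H] equals Ψ(P). -/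
open MeasureTheory

noncomputable section

namespace TransportSetup

section Helpers
variable {Ω : Type*} [MeasurableSpace Ω]
  {𝒲 : Type*} [MeasurableSpace 𝒲] [MeasurableSingletonClass 𝒲]
  [Fintype 𝒲] [Nonempty 𝒲]
variable (T : TransportSetup Ω 𝒲)

theorem pr_pos_of_cell (E : Set Ω) (s x z m : Fin 2) (w : 𝒲)
    (h : ∀ ω, T.S ω = s → T.W ω = w → T.A ω = x → T.Z ω = z → T.M ω = m → ω ∈ E) :
    0 < T.pr E := by
  haveI := T.isProb
  obtain ⟨y, hy⟩ := T.ySet_nonempty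
  refine ENNReal.toReal_pos (ne_of_gt ?_) (measure_ne_top _ _)
  refine lt_of_lt_of_le (T.positivity s x z m w y hy) (measure_mono ?_)
  rintro ω ⟨h1, h2, h3, h4, h5, -⟩
  exact h ω h1 h2 h3 h4 h5

theorem measurableSet_cell (m z x : Fin 2) (w : 𝒲) :
    MeasurableSet {ω | T.M ω = m ∧ T.Z ω = z ∧ T.A ω = x ∧ T.W ω = w ∧ T.S ω = 1} := by
  have h1 := T.measM (measurableSet_singleton m)
  have h2 := T.measZ (measurableSet_singleton z)
  have h3 := T.measA (measurableSet_singleton x)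
  have h4 := T.measW (measurableSet_singleton w)
  have h5 := T.measS (measurableSet_singleton (1 : Fin 2))
  exact h1.inter (h2.inter (h3.inter (h4.inter h5)))

/-- value of the weight on a cell -/
def cellWt (gs : Fin 2 → 𝒲 → ℝ) (a m z : Fin 2) (w : 𝒲) : ℝ :=
  (gs m w * T.pZ a z w 0 * T.pSW 0 w) /
  (T.pM m z a w * T.pZ a z w 1 * T.pA a w 1 * T.pSW 1 w * T.pS0)

theorem cellWt_eq (gs : Fin 2 → 𝒲 → ℝ) (a m z : Fin 2) (w : 𝒲) :
    T.cellWt gs a m z w = T.pWS0 w * T.pZ a z w 0 * gs m w /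
      T.pr {ω | T.M ω = m ∧ T.Z ω = z ∧ T.A ω = a ∧ T.W ω = w ∧ T.S ω = 1} := by
  have e1 : {ω | T.M ω = m} ∩ {ω | T.Z ω = z ∧ T.A ω = a ∧ T.W ω = w ∧ T.S ω = 1} =
    {ω | T.M ω = m ∧ T.Z ω = z ∧ T.A ω = a ∧ T.W ω = w ∧ T.S ω = 1} := rfl
  have e2 : {ω | T.Z ω = z} ∩ {ω | T.A ω = a ∧ T.W ω = w ∧ T.S ω = 1} =
    {ω | T.Z ω = z ∧ T.A ω = a ∧ T.W ω = w ∧ T.S ω = 1} := rfl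
  have e3 : {ω | T.A ω = a} ∩ {ω | T.W ω = w ∧ T.S ω = 1} =
    {ω | T.A ω = a ∧ T.W ω = w ∧ T.S ω = 1} := rfl
  have e4 : {ω | T.S ω = 1} ∩ {ω | T.W ω = w} = {ω | T.W ω = w ∧ T.S ω = 1} :=
    Set.inter_comm _ _
  have e5 : {ω | T.S ω = 0} ∩ {ω | T.W ω = w} = {ω | T.W ω = w} ∩ {ω | T.S ω = 0} :=
    Set.inter_comm _ _
  have p1 := T.pr_pos_of_cell
    {ω | T.M ω = m ∧ T.Z ω = z ∧ T.A ω = a ∧ T.W ω = w ∧ T.S ω = 1} 1 a z m w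
    (fun ω h1 h2 h3 h4 h5 => ⟨h5, h4, h3, h2, h1⟩)
  have p2 := T.pr_pos_of_cell
    {ω | T.Z ω = z ∧ T.A ω = a ∧ T.W ω = w ∧ T.S ω = 1} 1 a z m w
    (fun ω h1 h2 h3 h4 h5 => ⟨h4, h3, h2, h1⟩)
  have p3 := T.pr_pos_of_cell {ω | T.A ω = a ∧ T.W ω = w ∧ T.S ω = 1} 1 a z m w
    (fun ω h1 h2 h3 h4 h5 => ⟨h3, h2, h1⟩)
  have p4 := T.pr_pos_of_cell {ω | T.W ω = w ∧ T.S ω = 1} 1 a z m w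
    (fun ω h1 h2 h3 h4 h5 => ⟨h2, h1⟩)
  have p5 := T.pr_pos_of_cell {ω | T.W ω = w} 1 a z m w
    (fun ω h1 h2 h3 h4 h5 => h2)
  have p6 := T.pr_pos_of_cell {ω | T.S ω = 0} 0 a z m w
    (fun ω h1 h2 h3 h4 h5 => h1)
  unfold cellWt
  generalize T.pZ a z w 0 = q
  unfold pM pZ pA pSW pS0 pWS0 cpr
  rw [e1, e2, e3, e4, e5]
  field_simp

theorem Hwt_mul_eq (gs : Fin 2 → 𝒲 → ℝ) (a : Fin 2) (f : Ω → ℝ) (ω : Ω) :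
    T.Hwt gs a ω * f ω = ∑ w : 𝒲, ∑ z : Fin 2, ∑ m : Fin 2,
      Set.indicator {ω | T.M ω = m ∧ T.Z ω = z ∧ T.A ω = a ∧ T.W ω = w ∧ T.S ω = 1}
        (fun ω => T.cellWt gs a m z w * f ω) ω := by
  classical
  rw [Finset.sum_eq_single (T.W ω), Finset.sum_eq_single (T.Z ω),
    Finset.sum_eq_single (T.M ω)]
  · by_cases h : T.S ω = 1 ∧ T.A ω = a
    · rw [Set.indicator_of_mem (by exact ⟨rfl, rfl, h.2, rfl, h.1⟩)]
      simp [Hwt, cellWt, h]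
    · rw [Set.indicator_of_notMem (by rintro ⟨-, -, h2, -, h1⟩; exact h ⟨h1, h2⟩)]
      simp [Hwt, h]
  · intro m _ hm
    exact Set.indicator_of_notMem (fun h => hm h.1.symm) _
  · simp
  · intro z _ hz
    exact Finset.sum_eq_zero fun m _ => Set.indicator_of_notMem (fun h => hz h.2.1.symm) _
  · simp
  · intro w _ hw
    exact Finset.sum_eq_zero fun z _ => Finset.sum_eq_zero fun m _ =>
      Set.indicator_of_notMem (fun h => hw h.2.2.2.1.symm) _
  · simp

theorem integral_Hwt_mul (gs : Fin 2 → 𝒲 → ℝ) (a : Fin 2) (f : Ω → ℝ)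
    (hf : Integrable f T.P) :
    ∫ ω, T.Hwt gs a ω * f ω ∂T.P = ∑ w : 𝒲, ∑ z : Fin 2, ∑ m : Fin 2,
      T.pWS0 w * T.pZ a z w 0 * gs m w *
        T.cexp f {ω | T.M ω = m ∧ T.Z ω = z ∧ T.A ω = a ∧ T.W ω = w ∧ T.S ω = 1} := by
  have hi : ∀ w z m, Integrable (Set.indicator
      {ω | T.M ω = m ∧ T.Z ω = z ∧ T.A ω = a ∧ T.W ω = w ∧ T.S ω = 1}
        (fun ω => T.cellWt gs a m z w * f ω)) T.P := fun w z m =>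
    (hf.const_mul _).indicator (T.measurableSet_cell m z a w)
  simp_rw [T.Hwt_mul_eq gs a f]
  rw [integral_finsetSum _ fun w _ => integrable_finsetSum _ fun z _ =>
    integrable_finsetSum _ fun m _ => hi w z m]
  refine Finset.sum_congr rfl fun w _ => ?_
  rw [integral_finsetSum _ fun z _ => integrable_finsetSum _ fun m _ => hi w z m]
  refine Finset.sum_congr rfl fun z _ => ?_
  rw [integral_finsetSum _ fun m _ => hi w z m]
  refine Finset.sum_congr rfl fun m _ => ?_
  rw [integral_indicator (T.measurableSet_cell m z a w), integral_const_mul, cellWt_eq]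
  unfold cexp
  ring

theorem sum_pZ (a : Fin 2) (w : 𝒲) : T.pZ a 0 w 0 + T.pZ a 1 w 0 = 1 := by
  haveI := T.isProb
  have p := T.pr_pos_of_cell {ω | T.A ω = a ∧ T.W ω = w ∧ T.S ω = 0} 0 a 0 0 w
    (fun ω h1 h2 h3 h4 h5 => ⟨h3, h2, h1⟩)
  unfold pZ cpr
  rw [← add_div, div_eq_one_iff_eq p.ne']
  have hm : MeasurableSet {ω | T.Z ω = 0} := T.measZ (measurableSet_singleton 0)
  have hc : {ω | T.Z ω = 1} = {ω | T.Z ω = 0}ᶜ := by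
    ext ω
    simp only [Set.mem_setOf_eq, Set.mem_compl_iff]
    omega
  rw [hc, Set.inter_comm, Set.inter_comm _ᶜ, ← Set.diff_eq]
  exact measureReal_inter_add_diff (μ := T.P) hm

theorem sum_pWS0 : ∑ w : 𝒲, T.pWS0 w = 1 := by
  haveI := T.isProb
  have p := T.pr_pos_of_cell {ω | T.S ω = 0} 0 0 0 0 (Classical.arbitrary 𝒲)
    (fun ω h1 h2 h3 h4 h5 => h1)
  unfold pWS0 cpr
  rw [← Finset.sum_div, div_eq_one_iff_eq p.ne']
  have hS : MeasurableSet {ω | T.S ω = 0} := T.measS (measurableSet_singleton 0)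
  have hU : {ω | T.S ω = 0} = ⋃ w : 𝒲, ({ω | T.W ω = w} ∩ {ω | T.S ω = 0}) := by
    ext ω; simp
  have key := measureReal_iUnion_fintype (μ := T.P)
    (f := fun w : 𝒲 => {ω | T.W ω = w} ∩ {ω | T.S ω = 0})
    (fun w w' hww => Set.disjoint_left.2 fun ω h h' => hww (h.1.symm.trans h'.1))
    (fun w => (T.measW (measurableSet_singleton w)).inter hS)
  rw [← hU] at key
  exact key.symm

theorem integrable_Y : Integrable T.Y T.P := by
  haveI := T.isProb
  refine Integrable.of_bound T.measY.aestronglyMeasurable (∑ y ∈ T.ySet, ‖y‖)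
    (Filter.Eventually.of_forall fun ω => ?_)
  exact Finset.single_le_sum (f := fun y : ℝ => ‖y‖) (fun y _ => norm_nonneg y) (T.hY ω)

theorem integral_Hwt (gs : Fin 2 → 𝒲 → ℝ) (a : Fin 2)
    (hgs_sum : ∀ w : 𝒲, gs 0 w + gs 1 w = 1) : ∫ ω, T.Hwt gs a ω ∂T.P = 1 := by
  haveI := T.isProb
  have h := T.integral_Hwt_mul gs a (fun _ => 1) (integrable_const _)
  simp only [mul_one] at h
  refine h.trans (Eq.trans ?_ T.sum_pWS0)
  refine Finset.sum_congr rfl fun w _ => ?_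
  have hc : ∀ z m, T.cexp (fun _ => 1)
      {ω | T.M ω = m ∧ T.Z ω = z ∧ T.A ω = a ∧ T.W ω = w ∧ T.S ω = 1} = 1 := by
    intro z m
    have p1 := T.pr_pos_of_cell
      {ω | T.M ω = m ∧ T.Z ω = z ∧ T.A ω = a ∧ T.W ω = w ∧ T.S ω = 1} 1 a z m w
      (fun ω h1 h2 h3 h4 h5 => ⟨h5, h4, h3, h2, h1⟩)
    unfold cexp
    rw [div_eq_one_iff_eq p1.ne', setIntegral_const]
    simp [pr, Measure.real]
  simp only [hc, Fin.sum_univ_two]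
  linear_combination (T.pWS0 w * (T.pZ a 0 w 0 + T.pZ a 1 w 0)) * hgs_sum w
    + T.pWS0 w * T.sum_pZ a w

end Helpers

end TransportSetup

/-- The transport-mediation weight `H` satisfies `E_P[H] = 1` and
`E_P[H·Y] = Ψ(P)`; consequently the population stabilized IPTW functional
`E_P[H·Y] / E_P[H]` equals `Ψ(P)`. -/
theorem stabilized_iptw_identifies_transported_estimand
    {Ω : Type*} [MeasurableSpace Ω]
    {𝒲 : Type*} [MeasurableSpace 𝒲] [MeasurableSingletonClass 𝒲]
    [Fintype 𝒲] [Nonempty 𝒲]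
    (T : TransportSetup Ω 𝒲) (a : Fin 2)
    (gs : Fin 2 → 𝒲 → ℝ)
    (hgs_pos : ∀ (m : Fin 2) (w : 𝒲), 0 < gs m w ∧ gs m w < 1)
    (hgs_sum : ∀ w : 𝒲, gs 0 w + gs 1 w = 1) :
    (∫ ω, T.Hwt gs a ω ∂T.P) = 1 ∧
    (∫ ω, T.Hwt gs a ω * T.Y ω ∂T.P) = T.Psi gs a ∧
    (∫ ω, T.Hwt gs a ω * T.Y ω ∂T.P) / (∫ ω, T.Hwt gs a ω ∂T.P) = T.Psi gs a := by
  have h1 := T.integral_Hwt gs a hgs_sum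
  have h2 : (∫ ω, T.Hwt gs a ω * T.Y ω ∂T.P) = T.Psi gs a :=
    T.integral_Hwt_mul gs a T.Y T.integrable_Y
  exact ⟨h1, h2, by rw [h1, h2, div_one]⟩
end
end

section
/- Let 𝒪 be a nonempty finite set, p : 𝒪 → (0,1] a strictly positive probability mass function, and γ : 𝒪 → ℝ with Σ_{o∈𝒪} γ(o)·p(o) = 0 and sup_{o∈𝒪} |γ(o)| < 1; set p_ε(o) := (1 + ε·γ(o))·p(o) for ε ∈ (−1,1). Let U : 𝒪 → 𝒰 and V : 𝒪 → 𝒱 be functions into finite sets, and fix u ∈ 𝒰 and v ∈ 𝒱 such that the set {o ∈ 𝒪 : U(o)=u, V(o)=v} is nonempty. Then the map ε ↦ P_{p_ε}(U=u | V=v) is differentiable at ε = 0 with derivative (E_p[γ | U=u, V=v] − E_p[γ | V=v]) · P_p(U=u | V=v), where P_q and E_q denote conditional probability and conditional expectation with respect to the pmf q. -/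
open Finset

/-- For a strictly positive pmf `p` on a nonempty finite set `𝒪`,
a bounded score `γ` with `Σ γ·p = 0` and `sup |γ| < 1`, and the perturbed pmf
`p_ε(o) := (1 + ε·γ(o))·p(o)`, the map `ε ↦ P_{p_ε}(U=u | V=v)` is differentiable at
`ε = 0` with derivative `(E_p[γ | U=u, V=v] − E_p[γ | V=v]) · P_p(U=u | V=v)`. -/
theorem conditional_probability_pathwise_derivative
    {𝒪 𝒰 𝒱 : Type*} [Fintype 𝒪] [Nonempty 𝒪] [Fintype 𝒰] [Fintype 𝒱]
    [DecidableEq 𝒰] [DecidableEq 𝒱]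
    (p : 𝒪 → ℝ) (hp_pos : ∀ o, 0 < p o) (hp_le : ∀ o, p o ≤ 1)
    (hp_sum : ∑ o : 𝒪, p o = 1)
    (γ : 𝒪 → ℝ) (hγ_mean : ∑ o : 𝒪, γ o * p o = 0)
    (hγ_bdd : (⨆ o : 𝒪, |γ o|) < 1)
    (U : 𝒪 → 𝒰) (V : 𝒪 → 𝒱) (u : 𝒰) (v : 𝒱)
    (hne : {o : 𝒪 | U o = u ∧ V o = v}.Nonempty) :
    HasDerivAt
      -- `ε ↦ P_{p_ε}(U=u | V=v)`
      (fun ε : ℝ =>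
        (∑ o ∈ univ.filter (fun o => U o = u ∧ V o = v), (1 + ε * γ o) * p o) /
        (∑ o ∈ univ.filter (fun o => V o = v), (1 + ε * γ o) * p o))
      -- `(E_p[γ | U=u, V=v] − E_p[γ | V=v]) · P_p(U=u | V=v)`
      (((∑ o ∈ univ.filter (fun o => U o = u ∧ V o = v), γ o * p o) /
          (∑ o ∈ univ.filter (fun o => U o = u ∧ V o = v), p o) -
        (∑ o ∈ univ.filter (fun o => V o = v), γ o * p o) /
          (∑ o ∈ univ.filter (fun o => V o = v), p o)) *
        ((∑ o ∈ univ.filter (fun o => U o = u ∧ V o = v), p o) /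
          (∑ o ∈ univ.filter (fun o => V o = v), p o)))
      0 := by
  obtain ⟨o₀, hU, hV⟩ := hne
  have key : ∀ s : Finset 𝒪, HasDerivAt (fun ε : ℝ => ∑ o ∈ s, (1 + ε * γ o) * p o)
      (∑ o ∈ s, γ o * p o) 0 := by
    intro s
    apply HasDerivAt.fun_sum
    intro o _
    have h := (((hasDerivAt_id (0 : ℝ)).mul_const (γ o)).const_add 1).mul_const (p o)
    simpa using h
  have hA : 0 < ∑ o ∈ univ.filter (fun o => U o = u ∧ V o = v), p o :=
    Finset.sum_pos (fun o _ => hp_pos o) ⟨o₀, by simp [hU, hV]⟩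
  have hB : 0 < ∑ o ∈ univ.filter (fun o => V o = v), p o :=
    Finset.sum_pos (fun o _ => hp_pos o) ⟨o₀, by simp [hV]⟩
  have h := (key (univ.filter (fun o => U o = u ∧ V o = v))).fun_div
    (key (univ.filter (fun o => V o = v))) (by simpa using hB.ne')
  refine h.congr_deriv ?_
  simp only [zero_mul, add_zero, one_mul]
  have hA' := hA.ne'
  have hB' := hB.ne'
  generalize (∑ o ∈ univ.filter (fun o => U o = u ∧ V o = v), p o) = A at *
  generalize (∑ o ∈ univ.filter (fun o => V o = v), p o) = B at *
  field_simp
end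

section
/- The map ε ↦ Ψ(p_ε) is differentiable at ε = 0 and its derivative is the inner product of the score with the efficient influence curve: d/dε Ψ(p_ε)|_{ε=0} = Σ_{o∈𝒪} γ(o) · D*(P)(o) · p(o) = E_P[γ(O) · D*(P)(O)], where D*(P) is regarded as a function on 𝒪 via O = (S, W, A, Z, M, Y). -/
open Finset

noncomputable section

/-- The finite outcome space `𝒪 := {0,1} × 𝒲 × {0,1} × {0,1} × {0,1} × 𝒴` for the
observed data `O = (S, W, A, Z, M, Y)`, where `𝒴` is a finite set of reals. -/
abbrev Obs (𝒲 : Type*) (Ys : Finset ℝ) : Type _ :=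
  Fin 2 × 𝒲 × Fin 2 × Fin 2 × Fin 2 × {y : ℝ // y ∈ Ys}

namespace Obs

variable {𝒲 : Type*} {Ys : Finset ℝ}

/-- The site coordinate `S`. -/
def oS (o : Obs 𝒲 Ys) : Fin 2 := o.1
/-- The covariate coordinate `W`. -/
def oW (o : Obs 𝒲 Ys) : 𝒲 := o.2.1
/-- The treatment coordinate `A`. -/
def oA (o : Obs 𝒲 Ys) : Fin 2 := o.2.2.1
/-- The intermediate-variable coordinate `Z`. -/
def oZ (o : Obs 𝒲 Ys) : Fin 2 := o.2.2.2.1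
/-- The mediator coordinate `M`. -/
def oM (o : Obs 𝒲 Ys) : Fin 2 := o.2.2.2.2.1
/-- The outcome coordinate `Y`, as an element of `𝒴`. -/
def oYs (o : Obs 𝒲 Ys) : {y : ℝ // y ∈ Ys} := o.2.2.2.2.2
/-- The outcome coordinate `Y`, as a real number. -/
def oY (o : Obs 𝒲 Ys) : ℝ := (o.2.2.2.2.2 : ℝ)

end Obs

namespace TransportPMF

open Obs

variable {𝒲 : Type*} [Fintype 𝒲] {Ys : Finset ℝ}

open scoped Classical in
/-- The probability of an event under a pmf `q`. -/
def prE (q : Obs 𝒲 Ys → ℝ) (E : Obs 𝒲 Ys → Prop) : ℝ :=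
  ∑ o : Obs 𝒲 Ys, if E o then q o else 0

/-- Conditional probability `P_q(E | F)`. -/
def condP (q : Obs 𝒲 Ys → ℝ) (E F : Obs 𝒲 Ys → Prop) : ℝ :=
  prE q (fun o => E o ∧ F o) / prE q F

open scoped Classical in
/-- Conditional expectation `E_q[Y | F]` of the outcome coordinate given an event. -/
def condEY (q : Obs 𝒲 Ys → ℝ) (F : Obs 𝒲 Ys → Prop) : ℝ :=
  (∑ o : Obs 𝒲 Ys, if F o then oY o * q o else 0) / prE q F

/-- `Q̄_Y(m,z,x,w) = E_q[Y | M=m, Z=z, A=x, W=w, S=1]`. -/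
def qbarY (q : Obs 𝒲 Ys → ℝ) (m z x : Fin 2) (w : 𝒲) : ℝ :=
  condEY q (fun o => oM o = m ∧ oZ o = z ∧ oA o = x ∧ oW o = w ∧ oS o = 1)

/-- `P_q(Z=z | A=x, W=w, S=s)`. -/
def pZ (q : Obs 𝒲 Ys → ℝ) (x z : Fin 2) (w : 𝒲) (s : Fin 2) : ℝ :=
  condP q (fun o => oZ o = z) (fun o => oA o = x ∧ oW o = w ∧ oS o = s)

/-- `P_q(S=s | W=w)`. -/
def pSW (q : Obs 𝒲 Ys → ℝ) (s : Fin 2) (w : 𝒲) : ℝ :=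
  condP q (fun o => oS o = s) (fun o => oW o = w)

/-- `P_q(M=m | Z=z, A=x, W=w, S=1)`. -/
def pM (q : Obs 𝒲 Ys → ℝ) (m z x : Fin 2) (w : 𝒲) : ℝ :=
  condP q (fun o => oM o = m) (fun o => oZ o = z ∧ oA o = x ∧ oW o = w ∧ oS o = 1)

/-- `P_q(A=x | W=w, S=s)`. -/
def pA (q : Obs 𝒲 Ys → ℝ) (x : Fin 2) (w : 𝒲) (s : Fin 2) : ℝ :=
  condP q (fun o => oA o = x) (fun o => oW o = w ∧ oS o = s)

/-- `P_q(S=0)`. -/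
def pS0 (q : Obs 𝒲 Ys → ℝ) : ℝ := prE q (fun o => oS o = 0)

/-- `P_q(W=w | S=0)`. -/
def pWS0 (q : Obs 𝒲 Ys → ℝ) (w : 𝒲) : ℝ :=
  condP q (fun o => oW o = w) (fun o => oS o = 0)

/-- The transported estimand `Ψ(q)`. -/
def Psi (q : Obs 𝒲 Ys → ℝ) (gs : Fin 2 → 𝒲 → ℝ) (a : Fin 2) : ℝ :=
  ∑ w : 𝒲, ∑ z : Fin 2, ∑ m : Fin 2,
    pWS0 q w * pZ q a z w 0 * gs m w * qbarY q m z a w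

/-- The transport-mediation weight `H`, as a function on the outcome space. -/
def Hwt (q : Obs 𝒲 Ys → ℝ) (gs : Fin 2 → 𝒲 → ℝ) (a : Fin 2) (o : Obs 𝒲 Ys) : ℝ :=
  (gs (oM o) (oW o) * pZ q a (oZ o) (oW o) 0 * pSW q 0 (oW o) *
    (if oS o = 1 ∧ oA o = a then (1 : ℝ) else 0)) /
  (pM q (oM o) (oZ o) a (oW o) * pZ q a (oZ o) (oW o) 1 * pA q a (oW o) 1 *
    pSW q 1 (oW o) * pS0 q)

/-- `Q̄_M(z,x,w) = Σ_m g*(m|w) Q̄_Y(m,z,x,w)`. -/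
def qbarM (q : Obs 𝒲 Ys → ℝ) (gs : Fin 2 → 𝒲 → ℝ) (z x : Fin 2) (w : 𝒲) : ℝ :=
  ∑ m : Fin 2, gs m w * qbarY q m z x w

/-- `Q̄_Z(w) = Σ_z P_q(Z=z|A=a,W=w,S=0) Q̄_M(z,a,w)`. -/
def qbarZ (q : Obs 𝒲 Ys → ℝ) (gs : Fin 2 → 𝒲 → ℝ) (a : Fin 2) (w : 𝒲) : ℝ :=
  ∑ z : Fin 2, pZ q a z w 0 * qbarM q gs z a w

/-- `D_Y`, the `Y`-component of the efficient influence curve, on the outcome space. -/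
def DY (q : Obs 𝒲 Ys → ℝ) (gs : Fin 2 → 𝒲 → ℝ) (a : Fin 2) (o : Obs 𝒲 Ys) : ℝ :=
  (oY o - qbarY q (oM o) (oZ o) (oA o) (oW o)) * Hwt q gs a o

/-- `D_Z`, the `Z`-component of the efficient influence curve, on the outcome space. -/
def DZ (q : Obs 𝒲 Ys → ℝ) (gs : Fin 2 → 𝒲 → ℝ) (a : Fin 2) (o : Obs 𝒲 Ys) : ℝ :=
  (qbarM q gs (oZ o) a (oW o) - qbarZ q gs a (oW o)) *
    (if oS o = 0 ∧ oA o = a then (1 : ℝ) else 0) / (pA q a (oW o) 0 * pS0 q)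

/-- `D_W`, the `W`-component of the efficient influence curve, on the outcome space. -/
def DW (q : Obs 𝒲 Ys → ℝ) (gs : Fin 2 → 𝒲 → ℝ) (a : Fin 2) (o : Obs 𝒲 Ys) : ℝ :=
  (qbarZ q gs a (oW o) - Psi q gs a) *
    (if oS o = 0 then (1 : ℝ) else 0) / pS0 q

/-- The score-path perturbation `p_ε(o) := (1 + ε·γ(o))·p(o)`. -/
def pert (p γ : Obs 𝒲 Ys → ℝ) (ε : ℝ) (o : Obs 𝒲 Ys) : ℝ := (1 + ε * γ o) * p o

end TransportPMF

namespace TransportPMF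

open Obs

section helpers

variable {𝒲 : Type*} [Fintype 𝒲] {Ys : Finset ℝ}

open scoped Classical in
theorem aux_prE_pos (p : Obs 𝒲 Ys → ℝ) (hp : ∀ o, 0 < p o) (F : Obs 𝒲 Ys → Prop)
    (h : ∃ o, F o) : 0 < prE p F := by
  obtain ⟨o, ho⟩ := h
  unfold prE
  apply Finset.sum_pos'
  · intro i _
    split_ifs
    · exact (hp i).le
    · exact le_rfl
  · exact ⟨o, Finset.mem_univ _, by simp [ho, hp o]⟩

open scoped Classical in
theorem aux_lin (f p γ : Obs 𝒲 Ys → ℝ) (F : Obs 𝒲 Ys → Prop) :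
    HasDerivAt (fun ε : ℝ => ∑ o : Obs 𝒲 Ys, if F o then f o * pert p γ ε o else 0)
      (∑ o : Obs 𝒲 Ys, if F o then f o * (γ o * p o) else 0) 0 := by
  apply HasDerivAt.fun_sum
  intro o _
  split_ifs
  · have h : HasDerivAt (fun ε : ℝ => f o * ((1 + ε * γ o) * p o))
        (f o * ((1 * γ o) * p o)) 0 :=
      ((((hasDerivAt_id (0:ℝ)).mul_const (γ o)).const_add 1).mul_const (p o)).const_mul (f o)
    simpa [pert] using h
  · exact hasDerivAt_const _ _

theorem aux_pert_zero (p γ : Obs 𝒲 Ys → ℝ) : pert p γ 0 = p := by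
  funext o; simp [pert]

open scoped Classical in
theorem aux_ratio (f p γ : Obs 𝒲 Ys → ℝ) (F : Obs 𝒲 Ys → Prop) (hF : prE p F ≠ 0) :
    HasDerivAt (fun ε : ℝ => (∑ o : Obs 𝒲 Ys, if F o then f o * pert p γ ε o else 0) /
        prE (pert p γ ε) F)
      (∑ o : Obs 𝒲 Ys, if F o then
        (f o - (∑ o : Obs 𝒲 Ys, if F o then f o * p o else 0) / prE p F) * (γ o * p o)
          / prE p F else 0) 0 := by
  have h1 := aux_lin f p γ F
  have h2 : HasDerivAt (fun ε : ℝ => prE (pert p γ ε) F)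
      (∑ o : Obs 𝒲 Ys, if F o then (γ o * p o) else 0) 0 := by
    simpa [prE] using aux_lin (fun _ => 1) p γ F
  have h3 := h1.div h2 (by simpa [aux_pert_zero] using hF)
  simp only [aux_pert_zero] at h3
  refine h3.congr_deriv ?_
  generalize (∑ o : Obs 𝒲 Ys, if F o then f o * p o else 0) = N
  have : ∀ o, (if F o then (f o - N / prE p F) * (γ o * p o) / prE p F else 0)
      = (if F o then f o * (γ o * p o) else 0) / prE p F
        - N / prE p F ^ 2 * (if F o then (γ o * p o) else 0) := by
    intro o
    split_ifs
    · field_simp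
    · simp
  simp only [this, Finset.sum_sub_distrib, ← Finset.sum_div, ← Finset.mul_sum]
  field_simp

theorem aux_condEY (p γ : Obs 𝒲 Ys → ℝ) (F : Obs 𝒲 Ys → Prop) [DecidablePred F]
    (hF : prE p F ≠ 0) :
    HasDerivAt (fun ε : ℝ => condEY (pert p γ ε) F)
      (∑ o : Obs 𝒲 Ys, if F o then
        (oY o - condEY p F) * (γ o * p o) / prE p F else 0) 0 := by
  obtain rfl : ‹DecidablePred F› = fun o => Classical.propDecidable (F o) :=
    Subsingleton.elim _ _
  exact aux_ratio oY p γ F hF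

theorem aux_condP (p γ : Obs 𝒲 Ys → ℝ) (E F : Obs 𝒲 Ys → Prop) [DecidablePred F]
    [DecidablePred E] (hF : prE p F ≠ 0) :
    HasDerivAt (fun ε : ℝ => condP (pert p γ ε) E F)
      (∑ o : Obs 𝒲 Ys, if F o then
        ((if E o then 1 else 0) - condP p E F) * (γ o * p o) / prE p F else 0) 0 := by
  obtain rfl : ‹DecidablePred F› = fun o => Classical.propDecidable (F o) :=
    Subsingleton.elim _ _
  classical
  have key : ∀ q : Obs 𝒲 Ys → ℝ, condP q E F =
      (∑ o : Obs 𝒲 Ys, if F o then (if E o then 1 else 0) * q o else 0) / prE q F := by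
    intro q
    unfold condP
    congr 1
    unfold prE
    apply Finset.sum_congr rfl
    intro o _
    by_cases hE : E o <;> by_cases hF : F o <;> simp [hE, hF]
  have := aux_ratio (fun o => if E o then (1:ℝ) else 0) p γ F hF
  simp only [key]
  exact this

end helpers

end TransportPMF

open TransportPMF in
/-- The map `ε ↦ Ψ(p_ε)` is differentiable at `ε = 0` and its
derivative is the inner product of the score with the efficient influence curve:
`d/dε Ψ(p_ε)|₀ = Σ_o γ(o) · D*(P)(o) · p(o) = E_P[γ(O)·D*(P)(O)]`. -/
theorem pathwise_derivative_of_transported_estimand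
    {𝒲 : Type*} [Fintype 𝒲] [Nonempty 𝒲] {Ys : Finset ℝ} (hYs : Ys.Nonempty)
    -- `p` is the (strictly positive) joint pmf of `O = (S, W, A, Z, M, Y)`
    (p : Obs 𝒲 Ys → ℝ) (hp_pos : ∀ o, 0 < p o) (hp_sum : ∑ o : Obs 𝒲 Ys, p o = 1)
    (a : Fin 2)
    (gs : Fin 2 → 𝒲 → ℝ)
    (hgs_pos : ∀ (m : Fin 2) (w : 𝒲), 0 < gs m w ∧ gs m w < 1)
    (hgs_sum : ∀ w : 𝒲, gs 0 w + gs 1 w = 1)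
    -- the score `γ`
    (γ : Obs 𝒲 Ys → ℝ) (hγ_mean : ∑ o : Obs 𝒲 Ys, γ o * p o = 0)
    (hγ_bdd : (⨆ o : Obs 𝒲 Ys, |γ o|) < 1) :
    HasDerivAt (fun ε : ℝ => Psi (pert p γ ε) gs a)
      (∑ o : Obs 𝒲 Ys, γ o * (DY p gs a o + DZ p gs a o + DW p gs a o) * p o) 0 := by
  classical
  obtain ⟨y0, hy0⟩ := hYs
  have pos : ∀ (s : Fin 2) (w : 𝒲) (x z m : Fin 2) (F : Obs 𝒲 Ys → Prop),
      F (s, w, x, z, m, ⟨y0, hy0⟩) → prE p F ≠ 0 :=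
    fun s w x z m F h => (aux_prE_pos p hp_pos F ⟨_, h⟩).ne'
  have hW : ∀ w, HasDerivAt (fun ε : ℝ => pWS0 (pert p γ ε) w) _ 0 := fun w =>
    aux_condP p γ (fun o => Obs.oW o = w) (fun o => Obs.oS o = 0) (pos 0 w 0 0 0 _ rfl)
  have hZ : ∀ z w, HasDerivAt (fun ε : ℝ => pZ (pert p γ ε) a z w 0) _ 0 := fun z w =>
    aux_condP p γ (fun o => Obs.oZ o = z) (fun o => Obs.oA o = a ∧ Obs.oW o = w ∧ Obs.oS o = 0)
      (pos 0 w a 0 0 _ ⟨rfl, rfl, rfl⟩)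
  have hY : ∀ m z w, HasDerivAt (fun ε : ℝ => qbarY (pert p γ ε) m z a w) _ 0 := fun m z w =>
    aux_condEY p γ (fun o => Obs.oM o = m ∧ Obs.oZ o = z ∧ Obs.oA o = a ∧ Obs.oW o = w ∧
      Obs.oS o = 1) (pos 1 w a z m _ ⟨rfl, rfl, rfl, rfl, rfl⟩)
  have hPsi : HasDerivAt (fun ε : ℝ => Psi (pert p γ ε) gs a) _ 0 :=
    HasDerivAt.fun_sum (u := Finset.univ) fun w _ =>
      HasDerivAt.fun_sum (u := Finset.univ) fun z _ =>
      HasDerivAt.fun_sum (u := Finset.univ) fun m _ =>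
        (((hW w).fun_mul (hZ z w)).mul_const (gs m w)).fun_mul (hY m z w)
  refine hPsi.congr_deriv ?_
  simp only [aux_pert_zero]
  have eW : ∀ w, condP p (fun o => Obs.oW o = w) (fun o => Obs.oS o = 0) = pWS0 p w :=
    fun _ => rfl
  have eZ : ∀ z w, condP p (fun o => Obs.oZ o = z)
      (fun o => Obs.oA o = a ∧ Obs.oW o = w ∧ Obs.oS o = 0) = pZ p a z w 0 := fun _ _ => rfl
  have eY : ∀ m z w, condEY p (fun o => Obs.oM o = m ∧ Obs.oZ o = z ∧ Obs.oA o = a ∧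
      Obs.oW o = w ∧ Obs.oS o = 1) = qbarY p m z a w := fun _ _ _ => rfl
  simp only [eW, eZ, eY]
  have ePsi : Psi p gs a = ∑ w, pWS0 p w * qbarZ p gs a w := by
    simp only [Psi, qbarZ, qbarM, Finset.mul_sum]
    refine Finset.sum_congr rfl fun w _ => Finset.sum_congr rfl fun z _ =>
      Finset.sum_congr rfl fun m _ => by ring
  -- the three pieces
  have pW : ∑ o : Obs 𝒲 Ys, γ o * DW p gs a o * p o =
      ∑ w, (∑ o : Obs 𝒲 Ys, if Obs.oS o = 0 then ((if Obs.oW o = w then 1 else 0) - pWS0 p w) *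
        (γ o * p o) / prE p (fun o => Obs.oS o = 0) else 0) * qbarZ p gs a w := by
    simp only [Finset.sum_mul]
    rw [Finset.sum_comm]
    refine Finset.sum_congr rfl fun o _ => ?_
    unfold DW
    split_ifs with h
    · have : qbarZ p gs a (Obs.oW o) - Psi p gs a =
          ∑ w, ((if Obs.oW o = w then 1 else 0) - pWS0 p w) * qbarZ p gs a w := by
        simp [sub_mul, Finset.sum_sub_distrib, ePsi]
      rw [this, pS0]
      simp only [Finset.sum_mul, Finset.mul_sum, Finset.sum_div]
      refine Finset.sum_congr rfl fun w _ => by ring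
    · simp
  have pZ' : ∑ o : Obs 𝒲 Ys, γ o * DZ p gs a o * p o =
      ∑ w, ∑ z, pWS0 p w * (∑ o : Obs 𝒲 Ys, if Obs.oA o = a ∧ Obs.oW o = w ∧ Obs.oS o = 0 then
        ((if Obs.oZ o = z then 1 else 0) - pZ p a z w 0) *
        (γ o * p o) / prE p (fun o => Obs.oA o = a ∧ Obs.oW o = w ∧ Obs.oS o = 0) else 0) *
        qbarM p gs z a w := by
    have step : ∀ w : 𝒲, ∑ z, pWS0 p w * (∑ o : Obs 𝒲 Ys,
        if Obs.oA o = a ∧ Obs.oW o = w ∧ Obs.oS o = 0 then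
        ((if Obs.oZ o = z then 1 else 0) - pZ p a z w 0) *
        (γ o * p o) / prE p (fun o => Obs.oA o = a ∧ Obs.oW o = w ∧ Obs.oS o = 0) else 0) *
        qbarM p gs z a w = ∑ o : Obs 𝒲 Ys, if Obs.oW o = w then γ o * DZ p gs a o * p o else 0 := by
      intro w
      simp only [Finset.mul_sum, Finset.sum_mul]
      rw [Finset.sum_comm]
      refine Finset.sum_congr rfl fun o _ => ?_
      by_cases hw : Obs.oW o = w
      · by_cases h : Obs.oS o = 0 ∧ Obs.oA o = a
        · have e : qbarM p gs (Obs.oZ o) a w - qbarZ p gs a w =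
            ∑ z, ((if Obs.oZ o = z then 1 else 0) - pZ p a z w 0) * qbarM p gs z a w := by
            simp only [sub_mul, Finset.sum_sub_distrib, qbarZ]
            simp
          have c : pWS0 p w / prE p (fun o => Obs.oA o = a ∧ Obs.oW o = w ∧ Obs.oS o = 0)
              = 1 / (pA p a w 0 * pS0 p) := by
            have h1 := pos 0 w a 0 0 (fun o => Obs.oA o = a ∧ Obs.oW o = w ∧ Obs.oS o = 0)
              ⟨rfl, rfl, rfl⟩
            have h2 := pos 0 w a 0 0 (fun o => Obs.oW o = w ∧ Obs.oS o = 0) ⟨rfl, rfl⟩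
            have h3 := pos 0 w a 0 0 (fun o => Obs.oS o = 0) rfl
            unfold pWS0 pA pS0 condP
            field_simp
          simp only [DZ, hw, h, and_self, if_true, e, mul_one]
          rw [div_eq_mul_one_div _ (pA p a w 0 * pS0 p), ← c]
          simp only [Finset.mul_sum, Finset.sum_mul]
          refine Finset.sum_congr rfl fun w _ => by ring
        · have h' : ¬ (Obs.oA o = a ∧ Obs.oW o = w ∧ Obs.oS o = 0) := by tauto
          simp [DZ, h, h']
      · simp [hw]
    simp only [step]
    rw [Finset.sum_comm]
    simp
  have pY : ∑ o : Obs 𝒲 Ys, γ o * DY p gs a o * p o =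
      ∑ w, ∑ z, ∑ m, pWS0 p w * pZ p a z w 0 * gs m w * (∑ o : Obs 𝒲 Ys,
        if Obs.oM o = m ∧ Obs.oZ o = z ∧ Obs.oA o = a ∧ Obs.oW o = w ∧ Obs.oS o = 1 then
        (Obs.oY o - qbarY p m z a w) * (γ o * p o) / prE p (fun o => Obs.oM o = m ∧
          Obs.oZ o = z ∧ Obs.oA o = a ∧ Obs.oW o = w ∧ Obs.oS o = 1) else 0) := by
    have step : ∀ w z m, pWS0 p w * pZ p a z w 0 * gs m w * (∑ o : Obs 𝒲 Ys,
        if Obs.oM o = m ∧ Obs.oZ o = z ∧ Obs.oA o = a ∧ Obs.oW o = w ∧ Obs.oS o = 1 then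
        (Obs.oY o - qbarY p m z a w) * (γ o * p o) / prE p (fun o => Obs.oM o = m ∧
          Obs.oZ o = z ∧ Obs.oA o = a ∧ Obs.oW o = w ∧ Obs.oS o = 1) else 0) =
        ∑ o : Obs 𝒲 Ys, if Obs.oW o = w then if Obs.oZ o = z then if Obs.oM o = m then
          γ o * DY p gs a o * p o else 0 else 0 else 0 := by
      intro w z m
      simp only [Finset.mul_sum]
      refine Finset.sum_congr rfl fun o _ => ?_
      by_cases hw : Obs.oW o = w
      swap
      · simp [hw]
      by_cases hz : Obs.oZ o = z
      swap
      · simp [hz]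
      by_cases hm : Obs.oM o = m
      swap
      · simp [hm]
      by_cases h : Obs.oS o = 1 ∧ Obs.oA o = a
      · have c : pWS0 p w * pZ p a z w 0 * gs m w / prE p (fun o => Obs.oM o = m ∧
            Obs.oZ o = z ∧ Obs.oA o = a ∧ Obs.oW o = w ∧ Obs.oS o = 1)
            = (gs m w * pZ p a z w 0 * pSW p 0 w) / (pM p m z a w * pZ p a z w 1 * pA p a w 1 *
              pSW p 1 w * pS0 p) := by
          have h1 := pos 1 w a z m (fun o => Obs.oM o = m ∧
            Obs.oZ o = z ∧ Obs.oA o = a ∧ Obs.oW o = w ∧ Obs.oS o = 1) ⟨rfl, rfl, rfl, rfl, rfl⟩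
          have h2 := pos 1 w a z m (fun o => Obs.oZ o = z ∧ Obs.oA o = a ∧ Obs.oW o = w ∧
            Obs.oS o = 1) ⟨rfl, rfl, rfl, rfl⟩
          have h3 := pos 1 w a z m (fun o => Obs.oA o = a ∧ Obs.oW o = w ∧
            Obs.oS o = 1) ⟨rfl, rfl, rfl⟩
          have h4 := pos 1 w a z m (fun o => Obs.oW o = w ∧ Obs.oS o = 1) ⟨rfl, rfl⟩
          have h5 := pos 1 w a z m (fun o => Obs.oW o = w) rfl
          have h6 := pos 0 w a z m (fun o => Obs.oS o = 0) rfl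
          generalize hq : pZ p a z w 0 = q
          have sw : ∀ s, prE p (fun o => Obs.oS o = s ∧ Obs.oW o = w) =
              prE p (fun o => Obs.oW o = w ∧ Obs.oS o = s) := by
            intro s; congr 1; funext o; exact propext and_comm
          unfold pWS0 pA pS0 pSW pM pZ condP
          simp only [sw]
          field_simp
        have h' := h.1
        have h'' := h.2
        simp only [DY, Hwt, hw, hz, hm, h', h'', and_self, if_true, mul_one]
        rw [← c]
        ring
      · have h' : ¬ (Obs.oM o = m ∧ Obs.oZ o = z ∧ Obs.oA o = a ∧ Obs.oW o = w ∧
          Obs.oS o = 1) := by tauto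
        simp [DY, Hwt, h, h']
    simp only [step]
    have sc : ∀ w z, ∑ m, ∑ o : Obs 𝒲 Ys, (if Obs.oW o = w then if Obs.oZ o = z then
        if Obs.oM o = m then γ o * DY p gs a o * p o else 0 else 0 else 0) =
        ∑ o : Obs 𝒲 Ys, if Obs.oW o = w then if Obs.oZ o = z then
          γ o * DY p gs a o * p o else 0 else 0 := by
      intro w z
      rw [Finset.sum_comm]
      refine Finset.sum_congr rfl fun o _ => ?_
      split_ifs <;> simp
    have sc2 : ∀ w, ∑ z, ∑ o : Obs 𝒲 Ys, (if Obs.oW o = w then if Obs.oZ o = z then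
        γ o * DY p gs a o * p o else 0 else 0) =
        ∑ o : Obs 𝒲 Ys, if Obs.oW o = w then γ o * DY p gs a o * p o else 0 := by
      intro w
      rw [Finset.sum_comm]
      refine Finset.sum_congr rfl fun o _ => ?_
      split_ifs <;> simp
    simp only [sc, sc2]
    rw [Finset.sum_comm]
    simp
  simp only [mul_add, add_mul, Finset.sum_add_distrib]
  rw [pW, pZ', pY]
  have rearr : ∀ x y z A B : ℝ, A = x → B = y → A + B + z = z + y + x := by
    intro x y z A B h1 h2
    rw [h1, h2]; ring
  refine rearr _ _ _ _ _ ?_ ?_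
  · refine Finset.sum_congr rfl fun w _ => ?_
    simp only [qbarZ, qbarM, Fin.sum_univ_two]
    ring
  · refine Finset.sum_congr rfl fun w _ => Finset.sum_congr rfl fun z _ => ?_
    simp only [qbarM, Fin.sum_univ_two]
    ring
end
end

section
/- Define φ_Z(ε) := Σ_{w∈𝒲} Σ_{z,m∈{0,1}} E_p[Y | M=m, Z=z, A=a, W=w, S=1] · g*(m|w) · P_{p_ε}(Z=z | A=a, W=w, S=0) · P_p(W=w | S=0), i.e. only the intermediate-variable factor of the transported estimand is perturbed along the score path. Then φ_Z is differentiable at ε = 0 and φ_Z'(0) = Σ_{o∈𝒪} γ(o) · D_Z(o) · p(o), where D_Z is the Z-component of the efficient influence curve computed from p. -/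
open Finset

noncomputable section

open TransportPMF Obs in
lemma prE_pert' {𝒲 : Type*} [Fintype 𝒲] {Ys : Finset ℝ} (p γ : Obs 𝒲 Ys → ℝ) (ε : ℝ)
    (E : Obs 𝒲 Ys → Prop) :
    prE (pert p γ ε) E = prE p E + ε * prE (fun o => γ o * p o) E := by
  classical
  unfold prE pert
  rw [Finset.mul_sum, ← Finset.sum_add_distrib]
  refine Finset.sum_congr rfl fun o _ => ?_
  split_ifs <;> ring

open TransportPMF Obs in
lemma prE_pos' {𝒲 : Type*} [Fintype 𝒲] {Ys : Finset ℝ} (p : Obs 𝒲 Ys → ℝ)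
    (hp : ∀ o, 0 < p o) (E : Obs 𝒲 Ys → Prop) (o : Obs 𝒲 Ys) (ho : E o) : 0 < prE p E := by
  classical
  unfold prE
  refine Finset.sum_pos' (fun i _ => ?_) ⟨o, Finset.mem_univ _, ?_⟩
  · split_ifs
    · exact (hp i).le
    · exact le_rfl
  · rw [if_pos ho]; exact hp o

open TransportPMF Obs in
lemma prE_splitZ {𝒲 : Type*} [Fintype 𝒲] {Ys : Finset ℝ} (q : Obs 𝒲 Ys → ℝ)
    (F : Obs 𝒲 Ys → Prop) :
    prE q F = ∑ z : Fin 2, prE q (fun o => oZ o = z ∧ F o) := by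
  classical
  unfold prE
  rw [Finset.sum_comm]
  refine Finset.sum_congr rfl fun o _ => ?_
  by_cases h : F o <;> simp [h]

open TransportPMF Obs in
lemma hasDerivAt_pZ' {𝒲 : Type*} [Fintype 𝒲] {Ys : Finset ℝ} (p γ : Obs 𝒲 Ys → ℝ)
    (a z : Fin 2) (w : 𝒲)
    (hD : prE p (fun o => oA o = a ∧ oW o = w ∧ oS o = 0) ≠ 0) :
    HasDerivAt (fun ε => pZ (pert p γ ε) a z w 0)
      ((prE (fun o => γ o * p o) (fun o => oZ o = z ∧ oA o = a ∧ oW o = w ∧ oS o = 0)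
        - pZ p a z w 0 * prE (fun o => γ o * p o) (fun o => oA o = a ∧ oW o = w ∧ oS o = 0))
        / prE p (fun o => oA o = a ∧ oW o = w ∧ oS o = 0)) 0 := by
  unfold pZ condP
  simp only [prE_pert']
  have lin : ∀ c d : ℝ, HasDerivAt (fun ε : ℝ => c + ε * d) d 0 := fun c d => by
    simpa using ((hasDerivAt_id (0 : ℝ)).mul_const d).const_add c
  have := (lin (prE p (fun o => oZ o = z ∧ oA o = a ∧ oW o = w ∧ oS o = 0))
    (prE (fun o => γ o * p o) (fun o => oZ o = z ∧ oA o = a ∧ oW o = w ∧ oS o = 0))).div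
    (lin (prE p (fun o => oA o = a ∧ oW o = w ∧ oS o = 0))
      (prE (fun o => γ o * p o) (fun o => oA o = a ∧ oW o = w ∧ oS o = 0))) (by simpa using hD)
  refine this.congr_deriv ?_
  simp only [zero_mul, add_zero]
  field_simp

open TransportPMF Obs in
/-- Perturbing only the intermediate-variable factor of the
transported estimand along the score path, the resulting map `φ_Z` is differentiable
at `ε = 0` with derivative `Σ_o γ(o) · D_Z(o) · p(o)`. -/
theorem pathwise_derivative_intermediate_factor
    {𝒲 : Type*} [Fintype 𝒲] [Nonempty 𝒲] {Ys : Finset ℝ} (hYs : Ys.Nonempty)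
    -- `p` is the (strictly positive) joint pmf of `O = (S, W, A, Z, M, Y)`
    (p : Obs 𝒲 Ys → ℝ) (hp_pos : ∀ o, 0 < p o) (hp_sum : ∑ o : Obs 𝒲 Ys, p o = 1)
    (a : Fin 2)
    (gs : Fin 2 → 𝒲 → ℝ)
    (hgs_pos : ∀ (m : Fin 2) (w : 𝒲), 0 < gs m w ∧ gs m w < 1)
    (hgs_sum : ∀ w : 𝒲, gs 0 w + gs 1 w = 1)
    -- the score `γ`
    (γ : Obs 𝒲 Ys → ℝ) (hγ_mean : ∑ o : Obs 𝒲 Ys, γ o * p o = 0)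
    (hγ_bdd : (⨆ o : Obs 𝒲 Ys, |γ o|) < 1)
    -- `φ_Z`: only the intermediate-variable factor is perturbed along the score path
    (φZ : ℝ → ℝ)
    (hφZ : φZ = fun ε : ℝ =>
      ∑ w : 𝒲, ∑ z : Fin 2, ∑ m : Fin 2,
        qbarY p m z a w * gs m w * pZ (pert p γ ε) a z w 0 * pWS0 p w) :
    HasDerivAt φZ (∑ o : Obs 𝒲 Ys, γ o * DZ p gs a o * p o) 0 := by
  classical
  subst hφZ
  obtain ⟨y0, hy0⟩ := hYs
  have hD : ∀ w, prE p (fun o => oA o = a ∧ oW o = w ∧ oS o = 0) ≠ 0 := fun w =>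
    (prE_pos' p hp_pos _ ((0, w, a, 0, 0, ⟨y0, hy0⟩) : Obs 𝒲 Ys)
      (by simp [oA, oW, oS])).ne'
  have hW : ∀ w, prE p (fun o => oW o = w ∧ oS o = 0) ≠ 0 := fun w =>
    (prE_pos' p hp_pos _ ((0, w, a, 0, 0, ⟨y0, hy0⟩) : Obs 𝒲 Ys)
      (by simp [oW, oS])).ne'
  have hS : prE p (fun o => oS o = 0) ≠ 0 :=
    (prE_pos' p hp_pos _ ((0, Classical.arbitrary 𝒲, a, 0, 0, ⟨y0, hy0⟩) : Obs 𝒲 Ys)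
      (by simp [oS])).ne'
  have hder := HasDerivAt.fun_sum (u := (Finset.univ : Finset 𝒲)) fun w _ =>
    HasDerivAt.fun_sum (u := (Finset.univ : Finset (Fin 2))) fun z _ =>
    HasDerivAt.fun_sum (u := (Finset.univ : Finset (Fin 2))) fun m _ =>
      ((hasDerivAt_pZ' p γ a z w (hD w)).const_mul (qbarY p m z a w * gs m w)).mul_const
        (pWS0 p w)
  refine hder.congr_deriv ?_
  have hc : ∀ w, pWS0 p w / prE p (fun o => oA o = a ∧ oW o = w ∧ oS o = 0)
      = 1 / (pA p a w 0 * pS0 p) := fun w => by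
    have h1 := hD w
    have h2 := hW w
    unfold pWS0 pA pS0 condP
    field_simp
  have hR : ∀ o : Obs 𝒲 Ys, γ o * DZ p gs a o * p o = ∑ w : 𝒲, ∑ z : Fin 2,
      ((qbarM p gs z a w - qbarZ p gs a w) * (1 / (pA p a w 0 * pS0 p))) *
        (if (oZ o = z ∧ oA o = a ∧ oW o = w ∧ oS o = 0) then γ o * p o else 0) := fun o => by
    rw [Finset.sum_eq_single (oW o), Finset.sum_eq_single (oZ o)]
    · unfold DZ
      by_cases h1 : oS o = 0 <;> by_cases h2 : oA o = a <;> simp [h1, h2]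
      ring
    · intro z _ hz
      simp [hz.symm]
    · simp
    · intro w _ hw
      simp [hw.symm]
    · simp
  simp only [hR]
  symm
  rw [Finset.sum_comm]
  refine Finset.sum_congr rfl fun w _ => ?_
  rw [Finset.sum_comm]
  simp only [← Finset.mul_sum, ← hc]
  have hN : ∀ z : Fin 2, (∑ o : Obs 𝒲 Ys,
      if (oZ o = z ∧ oA o = a ∧ oW o = w ∧ oS o = 0) then γ o * p o else 0)
      = prE (fun o => γ o * p o) (fun o => oZ o = z ∧ oA o = a ∧ oW o = w ∧ oS o = 0) := by
    intro z
    unfold prE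
    refine Finset.sum_congr rfl fun o _ => ?_
    congr
  simp only [hN]
  rw [prE_splitZ (fun o => γ o * p o) (fun o => oA o = a ∧ oW o = w ∧ oS o = 0)]
  simp only [qbarZ, qbarM, Fin.sum_univ_two]
  ring
end
end

section
/- Define φ_W(ε) := Σ_{w∈𝒲} Σ_{z,m∈{0,1}} E_p[Y | M=m, Z=z, A=a, W=w, S=1] · g*(m|w) · P_p(Z=z | A=a, W=w, S=0) · P_{p_ε}(W=w | S=0), i.e. only the covariate factor of the transported estimand is perturbed along the score path. Then φ_W is differentiable at ε = 0 and φ_W'(0) = Σ_{o∈𝒪} γ(o) · D_W(o) · p(o), where D_W is the W-component of the efficient influence curve computed from p. -/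
open Finset

noncomputable section

namespace TransportPMF

open Obs

lemma prE_pert {𝒲 : Type*} [Fintype 𝒲] {Ys : Finset ℝ} (p γ : Obs 𝒲 Ys → ℝ) (ε : ℝ)
    (E : Obs 𝒲 Ys → Prop) :
    prE (pert p γ ε) E = prE p E + ε * prE (fun o => γ o * p o) E := by
  classical
  unfold prE pert
  rw [Finset.mul_sum, ← Finset.sum_add_distrib]
  refine Finset.sum_congr rfl fun o _ => ?_
  split_ifs <;> ring

lemma hasDerivAt_prE {𝒲 : Type*} [Fintype 𝒲] {Ys : Finset ℝ} (p γ : Obs 𝒲 Ys → ℝ)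
    (E : Obs 𝒲 Ys → Prop) :
    HasDerivAt (fun ε => prE (pert p γ ε) E) (prE (fun o => γ o * p o) E) 0 := by
  simp only [prE_pert]
  simpa using ((hasDerivAt_id (0 : ℝ)).mul_const
    (prE (fun o => γ o * p o) E)).const_add (prE p E)

lemma sum_fiber {𝒲 : Type*} [Fintype 𝒲] {Ys : Finset ℝ} (h : Obs 𝒲 Ys → ℝ) (f : 𝒲 → ℝ) :
    ∑ w : 𝒲, f w * prE h (fun o => oW o = w ∧ oS o = 0)
      = ∑ o : Obs 𝒲 Ys, f (oW o) * (if oS o = 0 then h o else 0) := by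
  classical
  unfold prE
  simp only [Finset.mul_sum]
  rw [Finset.sum_comm]
  refine Finset.sum_congr rfl fun o _ => ?_
  rw [Finset.sum_eq_single (oW o)]
  · simp
  · intro w _ hw
    simp [Ne.symm hw]
  · simp

end TransportPMF

open TransportPMF Obs in
/-- Perturbing only the covariate factor of the transported estimand
along the score path, the resulting map `φ_W` is differentiable at `ε = 0` with
derivative `Σ_o γ(o) · D_W(o) · p(o)`. -/
theorem pathwise_derivative_covariate_factor
    {𝒲 : Type*} [Fintype 𝒲] [Nonempty 𝒲] {Ys : Finset ℝ} (hYs : Ys.Nonempty)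
    -- `p` is the (strictly positive) joint pmf of `O = (S, W, A, Z, M, Y)`
    (p : Obs 𝒲 Ys → ℝ) (hp_pos : ∀ o, 0 < p o) (hp_sum : ∑ o : Obs 𝒲 Ys, p o = 1)
    (a : Fin 2)
    (gs : Fin 2 → 𝒲 → ℝ)
    (hgs_pos : ∀ (m : Fin 2) (w : 𝒲), 0 < gs m w ∧ gs m w < 1)
    (hgs_sum : ∀ w : 𝒲, gs 0 w + gs 1 w = 1)
    -- the score `γ`
    (γ : Obs 𝒲 Ys → ℝ) (hγ_mean : ∑ o : Obs 𝒲 Ys, γ o * p o = 0)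
    (hγ_bdd : (⨆ o : Obs 𝒲 Ys, |γ o|) < 1)
    -- `φ_W`: only the covariate factor is perturbed along the score path
    (φW : ℝ → ℝ)
    (hφW : φW = fun ε : ℝ =>
      ∑ w : 𝒲, ∑ z : Fin 2, ∑ m : Fin 2,
        qbarY p m z a w * gs m w * pZ p a z w 0 * pWS0 (pert p γ ε) w) :
    HasDerivAt φW (∑ o : Obs 𝒲 Ys, γ o * DW p gs a o * p o) 0 := by
  classical
  have hD : 0 < pS0 p := by
    unfold pS0 prE
    obtain ⟨y, hy⟩ := hYs
    obtain ⟨w⟩ := ‹Nonempty 𝒲›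
    refine Finset.sum_pos' (fun o _ => ?_) ⟨((0, w, 0, 0, 0, ⟨y, hy⟩) : Obs 𝒲 Ys), Finset.mem_univ _, ?_⟩
    · split_ifs
      · exact (hp_pos o).le
      · exact le_rfl
    · rw [if_pos (show oS ((0, w, 0, 0, 0, ⟨y, hy⟩) : Obs 𝒲 Ys) = 0 from rfl)]
      exact hp_pos _
  have hp0 : ∀ E : Obs 𝒲 Ys → Prop, prE (pert p γ 0) E = prE p E := by
    intro E
    simp [prE_pert]
  have hφ : φW = fun ε : ℝ => ∑ w : 𝒲, qbarZ p gs a w * pWS0 (pert p γ ε) w := by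
    rw [hφW]
    funext ε
    refine Finset.sum_congr rfl fun w _ => ?_
    simp only [qbarZ, qbarM, Fin.sum_univ_two]
    ring
  have hPsi : Psi p gs a = ∑ w : 𝒲, qbarZ p gs a w * pWS0 p w := by
    unfold Psi
    refine Finset.sum_congr rfl fun w _ => ?_
    simp only [qbarZ, qbarM, Fin.sum_univ_two]
    ring
  have hW : ∀ w : 𝒲, HasDerivAt (fun ε => qbarZ p gs a w * pWS0 (pert p γ ε) w)
      (qbarZ p gs a w * ((prE (fun o => γ o * p o) (fun o => oW o = w ∧ oS o = 0) * pS0 p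
        - prE p (fun o => oW o = w ∧ oS o = 0) * prE (fun o => γ o * p o) (fun o => oS o = 0))
          / pS0 p ^ 2)) 0 := by
    intro w
    have h := (hasDerivAt_prE p γ (fun o => oW o = w ∧ oS o = 0)).div
      (hasDerivAt_prE p γ (fun o => oS o = 0)) (by rw [hp0]; exact hD.ne')
    simp only [hp0] at h
    exact h.const_mul _
  rw [hφ]
  refine (HasDerivAt.fun_sum fun w _ => hW w).congr_deriv ?_
  have h1 : ∑ o : Obs 𝒲 Ys, γ o * DW p gs a o * p o
      = ((∑ w : 𝒲, qbarZ p gs a w * prE (fun o => γ o * p o) (fun o => oW o = w ∧ oS o = 0))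
        - Psi p gs a * prE (fun o => γ o * p o) (fun o => oS o = 0)) / pS0 p := by
    rw [sum_fiber]
    unfold prE
    rw [Finset.mul_sum, ← Finset.sum_sub_distrib, Finset.sum_div]
    refine Finset.sum_congr rfl fun o _ => ?_
    unfold DW
    split_ifs <;> ring
  rw [h1, hPsi, Finset.sum_mul, ← Finset.sum_sub_distrib, Finset.sum_div]
  refine Finset.sum_congr rfl fun w _ => ?_
  have hw : pWS0 p w = prE p (fun o => oW o = w ∧ oS o = 0) / pS0 p := rfl
  rw [hw]
  have := hD.ne'
  field_simp
end
end
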